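/- arXiv:2007.04501 — 2 statements merged into one kernel-verified Lean document; each statement's English description precedes it below -/
import Mathlib

section
/- For every integer n ≥ 1, the Fourier transform of the product g_n · ∂_x f_n is supported in the annulus {ξ ∈ ℝ : (17/12)2^n − 1 ≤ |ξ| ≤ (17/12)2^n + 1}. -/
open MeasureTheory Filter

/-- The Fourier transform with normalization `𝓕f(ξ) = ∫ e^{-ixξ} f(x) dx`. -/
noncomputable def FT (f : ℝ → ℝ) (ξ : ℝ) : ℂ :=
  ∫ x : ℝ, Complex.exp (-(Complex.I * ξ * x)) * (f x : ℂ)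

open scoped FourierTransform SchwartzMap

theorem FT_eq_fourier (f : ℝ → ℝ) (ξ : ℝ) :
    FT f ξ = 𝓕 (fun x => (f x : ℂ)) (ξ / (2 * Real.pi)) := by
  rw [Real.fourier_real_eq_integral_exp_smul, FT]
  refine integral_congr_ae (Eventually.of_forall fun x => ?_)
  have hpi : (Real.pi : ℂ) ≠ 0 := by exact_mod_cast Real.pi_ne_zero
  simp only [smul_eq_mul]
  congr 2
  push_cast
  field_simp

theorem norm_exp_neg_I_mul (ξ x : ℝ) : ‖Complex.exp (-(Complex.I * ξ * x))‖ = 1 := by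
  have : -(Complex.I * ξ * x) = ((-(ξ * x) : ℝ) : ℂ) * Complex.I := by push_cast; ring
  rw [this, Complex.norm_exp_ofReal_mul_I]

theorem integrable_exp_mul {f : ℝ → ℝ} (hf : Integrable f) (ξ : ℝ) :
    Integrable fun x : ℝ => Complex.exp (-(Complex.I * ξ * x)) * (f x : ℂ) := by
  refine hf.ofReal.bdd_mul (c := 1) ?_ (Eventually.of_forall fun x => ?_)
  · exact (by fun_prop : Continuous fun x : ℝ =>
      Complex.exp (-(Complex.I * ξ * x))).aestronglyMeasurable
  · rw [norm_exp_neg_I_mul]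

/-- The Fourier transform of a product vanishes at `ξ` when no frequency `y` of the first factor
and frequency `ξ - y` of the second add up to `ξ`. -/
theorem FT_mul_eq_zero (u : 𝓢(ℝ, ℝ)) {v : ℝ → ℝ} (hv : Integrable v) {ξ : ℝ}
    (h : ∀ y, FT (fun x => u x) y = 0 ∨ FT v (ξ - y) = 0) :
    FT (fun x => u x * v x) ξ = 0 := by
  let U : 𝓢(ℝ, ℂ) := u.postcompCLM Complex.ofRealCLM
  have hU (x : ℝ) : U x = (u x : ℂ) := rfl
  let V : 𝓢(ℝ, ℂ) := 𝓕⁻ U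
  let w : ℝ → ℂ := fun x => Complex.exp (-(Complex.I * ξ * x)) * (v x : ℂ)
  have hw : Integrable w := integrable_exp_mul hv ξ
  have hflip : ∫ x, 𝓕 (V : ℝ → ℂ) x • w x = ∫ y, V y • 𝓕 w y := by
    simpa only [flip_innerₗ] using!
      VectorFourier.integral_fourierIntegral_smul_eq_flip (μ := volume) (L := innerₗ ℝ)
        Real.continuous_fourierChar continuous_inner V.integrable hw
  have hinv (x : ℝ) : 𝓕 (V : ℝ → ℂ) x = (u x : ℂ) := by
    rw [← SchwartzMap.fourier_coe, FourierTransform.fourier_fourierInv_eq, hU]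
  have hpi := Real.pi_ne_zero
  have hUhat (y : ℝ) : V y = FT (fun x => u x) (-(2 * Real.pi * y)) := by
    rw [SchwartzMap.fourierInv_coe, Real.fourierInv_eq_fourier_neg, FT_eq_fourier]
    field_simp
    rfl
  have hwhat (y : ℝ) : 𝓕 w y = FT v (ξ - -(2 * Real.pi * y)) := by
    rw [Real.fourier_real_eq_integral_exp_smul, FT]
    refine integral_congr_ae (Eventually.of_forall fun x => ?_)
    simp only [w, smul_eq_mul, ← mul_assoc, ← Complex.exp_add]
    congr 2
    push_cast
    ring
  calc FT (fun x => u x * v x) ξ = ∫ x, 𝓕 (V : ℝ → ℂ) x • w x := by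
        refine integral_congr_ae (Eventually.of_forall fun x => ?_)
        simp only [hinv, w, smul_eq_mul]
        push_cast
        ring
    _ = ∫ y, V y • 𝓕 w y := hflip
    _ = 0 := by
        refine integral_eq_zero_of_ae (Eventually.of_forall fun y => ?_)
        rcases h (-(2 * Real.pi * y)) with h0 | h0 <;>
          simp only [hUhat, hwhat, h0, smul_zero, zero_smul, Pi.zero_apply]

theorem FT_const_mul (c : ℝ) (f : ℝ → ℝ) (ξ : ℝ) :
    FT (fun x => c * f x) ξ = c * FT f ξ := by
  rw [FT, FT, ← integral_const_mul]
  refine integral_congr_ae (Eventually.of_forall fun x => ?_)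
  push_cast
  ring

theorem FT_deriv {f : ℝ → ℝ} (hf : Integrable f) (hd : Differentiable ℝ f)
    (hf' : Integrable (deriv f)) (ξ : ℝ) : FT (deriv f) ξ = Complex.I * ξ * FT f ξ := by
  have hderiv : deriv (fun x => (f x : ℂ)) = fun x => ((deriv f x : ℝ) : ℂ) :=
    funext fun x => (hd x).hasDerivAt.ofReal_comp.deriv
  have key := Real.fourier_deriv hf.ofReal
    (fun x => (hd x).hasDerivAt.ofReal_comp.differentiableAt) (hderiv ▸ hf'.ofReal)
  have hpi : (Real.pi : ℂ) ≠ 0 := by exact_mod_cast Real.pi_ne_zero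
  rw [FT_eq_fourier, FT_eq_fourier, ← hderiv, key]
  simp only [smul_eq_mul]
  push_cast
  field_simp

theorem FT_mul_sin {f : ℝ → ℝ} (hf : Integrable f) (a ξ : ℝ) :
    FT (fun x => f x * Real.sin (a * x)) ξ =
      Complex.I / 2 * (FT f (ξ + a) - FT f (ξ - a)) := by
  rw [FT, FT, FT, ← integral_sub (integrable_exp_mul hf _) (integrable_exp_mul hf _),
    ← integral_const_mul]
  refine integral_congr_ae (Eventually.of_forall fun x => ?_)
  have h1 : Complex.exp (-(Complex.I * ((ξ + a : ℝ) : ℂ) * x)) =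
      Complex.exp (-(Complex.I * ξ * x)) * Complex.exp (-(a * x) * Complex.I) := by
    rw [← Complex.exp_add]; congr 1; push_cast; ring
  have h2 : Complex.exp (-(Complex.I * ((ξ - a : ℝ) : ℂ) * x)) =
      Complex.exp (-(Complex.I * ξ * x)) * Complex.exp (a * x * Complex.I) := by
    rw [← Complex.exp_add]; congr 1; push_cast; ring
  simp only [h1, h2]
  push_cast
  rw [Complex.sin]
  ring

theorem stmt6
    (φhat : ℝ → ℝ) (hsmooth : ContDiff ℝ (⊤ : ℕ∞) φhat) (hsupp : HasCompactSupport φhat)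
    (heven : ∀ ξ, φhat (-ξ) = φhat ξ)
    (hrange : ∀ ξ, 0 ≤ φhat ξ ∧ φhat ξ ≤ 1)
    (hone : ∀ ξ, |ξ| ≤ 1/4 → φhat ξ = 1)
    (hzero : ∀ ξ, 1/2 ≤ |ξ| → φhat ξ = 0)
    (φ : SchwartzMap ℝ ℝ)
    (hφ : ∀ ξ, FT (fun x => φ x) ξ = (φhat ξ : ℂ))
    (f g : ℕ → ℝ → ℝ)
    (hf : ∀ n x, f n x = (2:ℝ) ^ (-(3 * (n:ℝ)) / 2) * φ x * Real.sin ((17/12) * 2^n * x))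
    (hg : ∀ n x, g n x = (12/17) * (2:ℝ) ^ (-(n:ℝ)) * φ x) :
    ∀ n : ℕ, 1 ≤ n → ∀ ξ : ℝ,
      ¬((17/12) * 2^n - 1 ≤ |ξ| ∧ |ξ| ≤ (17/12) * 2^n + 1) →
      FT (fun x => g n x * deriv (f n) x) ξ = 0 := by
  intro n _ ξ hξ
  set a : ℝ := (17/12) * 2^n with ha
  set c : ℝ := (2:ℝ) ^ (-(3 * (n:ℝ)) / 2)
  have ha0 : 0 < a := by positivity
  have hφ0 (y : ℝ) (hy : 1/2 ≤ |y|) : FT (fun x => φ x) y = 0 := by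
    rw [hφ, hzero y hy, Complex.ofReal_zero]
  have hfn : f n = fun x => c * (φ x * Real.sin (a * x)) := by
    funext x
    rw [hf, mul_assoc]
  have hder (x : ℝ) : HasDerivAt (f n)
      (c * (deriv φ x * Real.sin (a * x) + φ x * (Real.cos (a * x) * a))) x := by
    rw [hfn]
    have hlin : HasDerivAt (fun x : ℝ => a * x) a x := by
      simpa using (hasDerivAt_id x).const_mul a
    exact ((φ.differentiableAt.hasDerivAt).mul hlin.sin).const_mul c
  have hint : Integrable (f n) := by
    rw [hfn]
    refine (φ.integrable.mul_bdd (c := 1) ?_ (Eventually.of_forall fun x => ?_)).const_mul c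
    · exact (by fun_prop : Continuous fun x : ℝ => Real.sin (a * x)).aestronglyMeasurable
    · exact Real.abs_sin_le_one _
  have hint' : Integrable (deriv (f n)) := by
    rw [funext fun x => (hder x).deriv]
    have hφ' : Integrable (deriv φ) := (SchwartzMap.derivCLM ℝ ℝ φ).integrable
    refine (Integrable.add ?_ ?_).const_mul c
    · refine hφ'.mul_bdd (c := 1) ?_ (Eventually.of_forall fun x => ?_)
      · exact (by fun_prop : Continuous fun x : ℝ => Real.sin (a * x)).aestronglyMeasurable
      · exact Real.abs_sin_le_one _
    · simp only [← mul_assoc]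
      refine (φ.integrable.mul_bdd (c := 1) ?_ (Eventually.of_forall fun x => ?_)).mul_const a
      · exact (by fun_prop : Continuous fun x : ℝ => Real.cos (a * x)).aestronglyMeasurable
      · exact Real.abs_cos_le_one _
  have hprod : FT (fun x => φ x * deriv (f n) x) ξ = 0 := by
    refine FT_mul_eq_zero φ hint' fun y => ?_
    rcases le_or_gt (1/2) |y| with hy | hy
    · exact Or.inl (hφ0 y hy)
    right
    have hfar : 1/2 ≤ |ξ - y + a| ∧ 1/2 ≤ |ξ - y - a| := by
      constructor <;>
      · by_contra! hlt
        rw [abs_lt] at hy hlt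
        apply hξ
        rcases abs_cases ξ with ⟨h1, h2⟩ | ⟨h1, h2⟩ <;> constructor <;> linarith
    rw [FT_deriv hint (fun x => (hder x).differentiableAt) hint', hfn, FT_const_mul,
      FT_mul_sin φ.integrable, hφ0 _ hfar.1, hφ0 _ hfar.2]
    simp
  have hgn : (fun x => g n x * deriv (f n) x) =
      fun x => ((12/17) * (2:ℝ) ^ (-(n:ℝ))) * (φ x * deriv (f n) x) := by
    funext x
    rw [hg, mul_assoc]
  rw [hgn, FT_const_mul, hprod, mul_zero]
end

section
/- One has the limit lim_{n → ∞} 2^{3n/2} ‖h_n² · ∂_x f_n‖_{L²(ℝ)} = (12/17)·2^{-1/2} ‖φ³‖_{L²(ℝ)}; in particular there exists a constant M₂ > 0 such that liminf_{n → ∞} 2^{3n/2} ‖h_n² · ∂_x f_n‖_{L²(ℝ)} ≥ M₂. -/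
open MeasureTheory Filter

open Topology

section RiemannLebesgue

theorem tendsto_integral_mul_cexp_atTop (F : ℝ → ℝ) :
    Tendsto (fun t : ℝ => ∫ x, (F x : ℂ) * Complex.exp ((-(t * x) : ℝ) * Complex.I))
      atTop (𝓝 0) := by
  have hpi : Tendsto (fun t : ℝ => t / (2 * Real.pi)) atTop (cocompact ℝ) :=
    (tendsto_id.atTop_div_const (by positivity)).mono_right atTop_le_cocompact
  refine ((Real.tendsto_integral_exp_smul_cocompact (fun x => (F x : ℂ))).comp hpi).congr
    fun t => integral_congr_ae (ae_of_all _ fun x => ?_)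
  have hexp : (2 * Real.pi * -(x * (t / (2 * Real.pi))) : ℝ) = -(t * x) := by
    field_simp
  simp only [Circle.smul_def, Real.fourierChar_apply, smul_eq_mul, hexp]
  exact mul_comm _ _

variable {F : ℝ → ℝ}

theorem integrable_mul_cexp (hF : Integrable F) (t : ℝ) :
    Integrable (fun x => (F x : ℂ) * Complex.exp ((-(t * x) : ℝ) * Complex.I)) := by
  refine hF.ofReal.mul_bdd (c := 1) (by fun_prop) (ae_of_all _ fun x => ?_)
  rw [Complex.norm_exp_ofReal_mul_I]

/-- Riemann-Lebesgue lemma for the cosine transform. -/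
theorem tendsto_integral_mul_cos_atTop (hF : Integrable F) :
    Tendsto (fun t : ℝ => ∫ x, F x * Real.cos (t * x)) atTop (𝓝 0) := by
  have h := (Complex.continuous_re.tendsto 0).comp (tendsto_integral_mul_cexp_atTop F)
  refine h.congr fun t => ?_
  refine (integral_re (integrable_mul_cexp hF t)).symm.trans ?_
  refine integral_congr_ae (ae_of_all _ fun x => ?_)
  simp only [RCLike.re_to_complex, Complex.re_ofReal_mul, Complex.exp_ofReal_mul_I_re,
    Real.cos_neg]

/-- Riemann-Lebesgue lemma for the sine transform. -/
theorem tendsto_integral_mul_sin_atTop (hF : Integrable F) :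
    Tendsto (fun t : ℝ => ∫ x, F x * Real.sin (t * x)) atTop (𝓝 0) := by
  have h := ((Complex.continuous_im.tendsto 0).comp (tendsto_integral_mul_cexp_atTop F)).neg
  rw [Complex.zero_im, neg_zero] at h
  refine h.congr fun t => ?_
  refine (congrArg Neg.neg (integral_im (integrable_mul_cexp hF t)).symm).trans ?_
  rw [← integral_neg]
  refine integral_congr_ae (ae_of_all _ fun x => ?_)
  simp only [RCLike.im_to_complex, Complex.im_ofReal_mul, Complex.exp_ofReal_mul_I_im,
    Real.sin_neg, mul_neg, neg_neg]

end RiemannLebesgue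

theorem toReal_eLpNorm_two_eq_sqrt {α : Type*} [MeasurableSpace α] {μ : Measure α} {g : α → ℝ}
    (hg : MemLp g 2 μ) : (eLpNorm g 2 μ).toReal = √(∫ x, g x ^ 2 ∂μ) := by
  rw [hg.eLpNorm_eq_integral_rpow_norm (by norm_num) (by norm_num),
    ENNReal.toReal_ofReal (by positivity), Real.sqrt_eq_rpow]
  norm_num

/-- The `L²` norm of a highly oscillating function with amplitudes `a A` and `ε B`, `ε → 0`. -/
theorem tendsto_eLpNorm_two_oscillation {ι : Type*} {l : Filter ι} {A B : ℝ → ℝ}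
    (hA : MemLp A 2) (hB : MemLp B 2) {a : ℝ} (ha : 0 ≤ a) {ε ω : ι → ℝ}
    (hε : Tendsto ε l (𝓝 0)) (hω : Tendsto ω l atTop) :
    Tendsto (fun i => (eLpNorm (fun x => a * (A x * Real.cos (ω i * x)) +
        ε i * (B x * Real.sin (ω i * x))) 2 volume).toReal) l
      (𝓝 (a * (2 : ℝ) ^ (-(1 : ℝ) / 2) * (eLpNorm A 2 volume).toReal)) := by
  have hcos (t : ℝ) : MemLp (fun x => A x * Real.cos (t * x)) 2 :=
    hA.of_le (by have := hA.1; fun_prop) (ae_of_all _ fun x => by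
      rw [norm_mul]
      exact mul_le_of_le_one_right (norm_nonneg _) (Real.abs_cos_le_one _))
  have hsin (t : ℝ) : MemLp (fun x => B x * Real.sin (t * x)) 2 :=
    hB.of_le (by have := hB.1; fun_prop) (ae_of_all _ fun x => by
      rw [norm_mul]
      exact mul_le_of_le_one_right (norm_nonneg _) (Real.abs_sin_le_one _))
  have hAA := hA.integrable_sq
  have hBB := hB.integrable_sq
  have hAB : Integrable (fun x => A x * B x) := hA.integrable_mul hB
  have hintcos {F : ℝ → ℝ} (hF : Integrable F) (t : ℝ) :
      Integrable (fun x => F x * Real.cos (t * x)) :=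
    hF.mul_bdd (c := 1) (by fun_prop) (ae_of_all _ fun x => Real.abs_cos_le_one _)
  have hintsin {F : ℝ → ℝ} (hF : Integrable F) (t : ℝ) :
      Integrable (fun x => F x * Real.sin (t * x)) :=
    hF.mul_bdd (c := 1) (by fun_prop) (ae_of_all _ fun x => Real.abs_sin_le_one _)
  have hexpand (i : ι) : ∫ x, (a * (A x * Real.cos (ω i * x)) +
        ε i * (B x * Real.sin (ω i * x))) ^ 2 =
      a ^ 2 / 2 * (∫ x, A x ^ 2) + a ^ 2 / 2 * (∫ x, A x ^ 2 * Real.cos (2 * ω i * x)) +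
        a * ε i * (∫ x, A x * B x * Real.sin (2 * ω i * x)) +
        ε i ^ 2 / 2 * ((∫ x, B x ^ 2) - ∫ x, B x ^ 2 * Real.cos (2 * ω i * x)) := by
    have hI₁ := (hAA.const_mul (a ^ 2 / 2)).fun_add
      ((hintcos hAA (2 * ω i)).const_mul (a ^ 2 / 2))
    have hI₂ := hI₁.fun_add ((hintsin hAB (2 * ω i)).const_mul (a * ε i))
    have hI₃ : Integrable (fun x => B x ^ 2 - B x ^ 2 * Real.cos (2 * ω i * x)) :=
      hBB.sub (hintcos hBB _)
    rw [← integral_sub hBB (hintcos hBB _)]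
    simp only [← integral_const_mul]
    rw [← integral_add (hAA.const_mul _) ((hintcos hAA _).const_mul _),
      ← integral_add hI₁ ((hintsin hAB _).const_mul _),
      ← integral_add hI₂ (hI₃.const_mul _)]
    refine integral_congr_ae (ae_of_all _ fun x => ?_)
    simp only [mul_assoc 2 (ω i) x, Real.cos_two_mul, Real.sin_two_mul]
    linear_combination ε i ^ 2 * B x ^ 2 * Real.sin_sq_add_cos_sq (ω i * x)
  have hω2 : Tendsto (fun i => 2 * ω i) l atTop := hω.const_mul_atTop two_pos
  have hlim : Tendsto (fun i => ∫ x, (a * (A x * Real.cos (ω i * x)) +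
      ε i * (B x * Real.sin (ω i * x))) ^ 2) l (𝓝 (a ^ 2 / 2 * ∫ x, A x ^ 2)) := by
    simp only [hexpand]
    have h1 := ((tendsto_integral_mul_cos_atTop hAA).comp hω2).const_mul (a ^ 2 / 2)
    have h2 := (hε.const_mul a).mul ((tendsto_integral_mul_sin_atTop hAB).comp hω2)
    have h3 := ((hε.pow 2).div_const 2).mul
      (((tendsto_integral_mul_cos_atTop hBB).comp hω2).const_sub (∫ x, B x ^ 2))
    simpa using ((h1.const_add (a ^ 2 / 2 * ∫ x, A x ^ 2)).add h2).add h3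
  have hconst : a * (2 : ℝ) ^ (-(1 : ℝ) / 2) * (eLpNorm A 2 volume).toReal =
      √(a ^ 2 / 2 * ∫ x, A x ^ 2) := by
    rw [toReal_eLpNorm_two_eq_sqrt hA, Real.sqrt_mul (by positivity), Real.sqrt_div (sq_nonneg a),
      Real.sqrt_sq ha, neg_div, Real.rpow_neg zero_le_two, ← Real.sqrt_eq_rpow, div_eq_mul_inv]
  rw [hconst]
  refine (hlim.sqrt).congr fun i => ?_
  exact (toReal_eLpNorm_two_eq_sqrt
    (((hcos (ω i)).const_mul a).add ((hsin (ω i)).const_mul (ε i)))).symm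

theorem rpow_mul_sq_mul_deriv_eq {φ f h : ℝ → ℝ} {n : ℕ} {x : ℝ} (hφ : DifferentiableAt ℝ φ x)
    (hf : ∀ x, f x = (2 : ℝ) ^ (-(3 * (n : ℝ)) / 2) * φ x * Real.sin ((17/12) * 2^n * x))
    (hh : h x = (12/17) * (2 : ℝ) ^ (-(n : ℝ) / 2) * φ x) :
    (2 : ℝ) ^ ((3 * (n : ℝ)) / 2) * (h x ^ 2 * deriv f x) =
      12/17 * (φ x ^ 3 * Real.cos ((17/12) * 2^n * x)) +
        (12/17) ^ 2 * (1/2) ^ n * (φ x ^ 2 * deriv φ x * Real.sin ((17/12) * 2^n * x)) := by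
  have hd : HasDerivAt f ((2 : ℝ) ^ (-(3 * (n : ℝ)) / 2) * deriv φ x *
      Real.sin ((17/12) * 2^n * x) + (2 : ℝ) ^ (-(3 * (n : ℝ)) / 2) * φ x *
      (Real.cos ((17/12) * 2^n * x) * ((17/12) * 2^n * 1))) x := by
    rw [show f = _ from funext hf]
    exact (hφ.hasDerivAt.const_mul _).mul (((hasDerivAt_id x).const_mul ((17/12) * 2^n : ℝ)).sin)
  have h1 : (2 : ℝ) ^ ((3 * (n : ℝ)) / 2) * (2 : ℝ) ^ (-(3 * (n : ℝ)) / 2) = 1 := by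
    rw [← Real.rpow_add two_pos]
    ring_nf
    simp
  have h2 : ((2 : ℝ) ^ (-(n : ℝ) / 2)) ^ 2 = (1/2) ^ n := by
    rw [← Real.rpow_natCast, ← Real.rpow_mul zero_le_two, one_div, inv_pow, ← Real.rpow_natCast,
      ← Real.rpow_neg zero_le_two]
    push_cast
    ring_nf
  have h3 : ((1/2 : ℝ)) ^ n * 2 ^ n = 1 := by
    rw [← mul_pow]
    norm_num
  rw [hd.deriv, hh]
  set s := Real.sin ((17/12) * 2^n * x)
  set c := Real.cos ((17/12) * 2^n * x)
  calc _ = ((2 : ℝ) ^ ((3 * (n : ℝ)) / 2) * (2 : ℝ) ^ (-(3 * (n : ℝ)) / 2)) *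
        ((12/17) ^ 2 * ((2 : ℝ) ^ (-(n : ℝ) / 2)) ^ 2 * φ x ^ 2 *
          (deriv φ x * s + φ x * c * (17/12 * 2 ^ n))) := by ring
    _ = _ := by
      rw [h1, h2]
      linear_combination 12/17 * φ x ^ 3 * c * h3

theorem stmt10
    (φhat : ℝ → ℝ) (hsmooth : ContDiff ℝ (⊤ : ℕ∞) φhat) (hsupp : HasCompactSupport φhat)
    (heven : ∀ ξ, φhat (-ξ) = φhat ξ)
    (hrange : ∀ ξ, 0 ≤ φhat ξ ∧ φhat ξ ≤ 1)
    (hone : ∀ ξ, |ξ| ≤ 1/4 → φhat ξ = 1)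
    (hzero : ∀ ξ, 1/2 ≤ |ξ| → φhat ξ = 0)
    (φ : SchwartzMap ℝ ℝ)
    (hφ : ∀ ξ, FT (fun x => φ x) ξ = (φhat ξ : ℂ))
    (f h : ℕ → ℝ → ℝ)
    (hf : ∀ n x, f n x = (2:ℝ) ^ (-(3 * (n:ℝ)) / 2) * φ x * Real.sin ((17/12) * 2^n * x))
    (hh : ∀ n x, h n x = (12/17) * (2:ℝ) ^ (-(n:ℝ) / 2) * φ x) :
    Tendsto
      (fun n : ℕ => (2:ℝ) ^ ((3 * (n:ℝ)) / 2) *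
        (eLpNorm (fun x => (h n x) ^ 2 * deriv (f n) x) 2 volume).toReal)
      atTop
      (nhds ((12/17) * (2:ℝ) ^ (-(1:ℝ) / 2) *
        (eLpNorm (fun x => (φ x) ^ 3) 2 volume).toReal)) ∧
    ∃ M₂ > (0:ℝ), M₂ ≤
      Filter.liminf
        (fun n : ℕ => (2:ℝ) ^ ((3 * (n:ℝ)) / 2) *
          (eLpNorm (fun x => (h n x) ^ 2 * deriv (f n) x) 2 volume).toReal)
        atTop := by
  have hφ2 : MemLp (fun x => φ x ^ 2) ⊤ := by
    simpa only [sq] using (φ.memLp_top volume).mul' (φ.memLp_top volume)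
  have hA : MemLp (fun x => φ x ^ 3) 2 := by
    simpa only [pow_succ _ 2] using (φ.memLp 2 volume).mul' hφ2
  have hB : MemLp (fun x => φ x ^ 2 * deriv φ x) 2 := by
    simpa only [SchwartzMap.derivCLM_apply] using
      ((SchwartzMap.derivCLM ℝ ℝ φ).memLp 2 volume).mul' hφ2
  have hε : Tendsto (fun n : ℕ => (12/17 : ℝ) ^ 2 * (1/2) ^ n) atTop (𝓝 0) := by
    simpa using (tendsto_pow_atTop_nhds_zero_of_lt_one (r := (1/2 : ℝ))
      (by norm_num) (by norm_num)).const_mul ((12/17 : ℝ) ^ 2)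
  have hω : Tendsto (fun n : ℕ => (17/12 : ℝ) * 2 ^ n) atTop atTop :=
    (tendsto_pow_atTop_atTop_of_one_lt one_lt_two).const_mul_atTop (by norm_num)
  have hlim := (tendsto_eLpNorm_two_oscillation hA hB (a := 12/17) (by norm_num) hε hω).congr
    (f₂ := fun n : ℕ => (2:ℝ) ^ ((3 * (n:ℝ)) / 2) *
      (eLpNorm (fun x => (h n x) ^ 2 * deriv (f n) x) 2 volume).toReal) fun n => by
    simp only [← rpow_mul_sq_mul_deriv_eq φ.differentiableAt (hf n) (hh n _)]
    refine (congrArg ENNReal.toReal (eLpNorm_const_smul ((2 : ℝ) ^ ((3 * (n : ℝ)) / 2))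
      (fun x => h n x ^ 2 * deriv (f n) x) 2 volume)).trans ?_
    rw [ENNReal.toReal_mul, toReal_enorm, Real.norm_of_nonneg (by positivity)]
  refine ⟨hlim, _, ?_, hlim.liminf_eq.ge⟩
  refine mul_pos (by positivity) (ENNReal.toReal_pos (fun h0 => ?_) hA.eLpNorm_ne_top)
  rw [eLpNorm_eq_zero_iff hA.1 two_ne_zero] at h0
  have hFT : FT (fun x => φ x) 0 = 0 := by
    refine integral_eq_zero_of_ae ?_
    filter_upwards [h0] with x hx
    simp [pow_eq_zero_iff three_ne_zero |>.mp hx]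
  simpa [hFT, hone 0 (by norm_num)] using hφ 0
end
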